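/- arXiv:math/0110062 — 3 statements merged into one kernel-verified Lean document; each statement's English description precedes it below -/
import Mathlib

section
/- Let k, τ, ω₂, ω₃ : ℝ × ℝ → ℝ be continuously differentiable and let e₁, e₂, e₃ : ℝ × ℝ → EuclideanSpace ℝ (Fin 3) be twice continuously differentiable such that at every point (x,t) the vectors e₁, e₂, e₃ are linearly independent and satisfy ∂ₓe₁ = k e₂, ∂ₓe₂ = −k e₁ + τ e₃, ∂ₓe₃ = −τ e₂, ∂ₜe₁ = ω₃ e₂ − ω₂ e₃, ∂ₜe₂ = −ω₃ e₁, ∂ₜe₃ = ω₂ e₁. Then at every point: ∂ₜk = ∂ₓω₃ + τ ω₂, ∂ₜτ = −k ω₂, and ∂ₓω₂ = τ ω₃. -/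
open scoped InnerProductSpace

/-- Partial derivative with respect to the first variable `x`. -/
noncomputable def pX {E : Type*} [NormedAddCommGroup E] [NormedSpace ℝ E]
    (f : ℝ × ℝ → E) (z : ℝ × ℝ) : E := fderiv ℝ f z (1, 0)

/-- Partial derivative with respect to the second variable `t`. -/
noncomputable def pT {E : Type*} [NormedAddCommGroup E] [NormedSpace ℝ E]
    (f : ℝ × ℝ → E) (z : ℝ × ℝ) : E := fderiv ℝ f z (0, 1)

/-- The cross product on three-dimensional Euclidean space. -/
noncomputable def cross3 (a b : EuclideanSpace ℝ (Fin 3)) : EuclideanSpace ℝ (Fin 3) :=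
  (EuclideanSpace.equiv (Fin 3) ℝ).symm
    (crossProduct ((EuclideanSpace.equiv (Fin 3) ℝ) a) ((EuclideanSpace.equiv (Fin 3) ℝ) b))

section Helpers
variable {E : Type*} [NormedAddCommGroup E] [NormedSpace ℝ E]

theorem pT_pX_comm {f : ℝ × ℝ → E} (hf : ContDiff ℝ 2 f) (z : ℝ × ℝ) :
    pT (pX f) z = pX (pT f) z := by
  have hd : DifferentiableAt ℝ (fderiv ℝ f) z :=
    ((hf.fderiv_right (m := 1) (by norm_num)).differentiable (by norm_num)) z
  have hs : IsSymmSndFDerivAt ℝ f z :=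
    hf.contDiffAt.isSymmSndFDerivAt (by simp)
  have h : ∀ v w : ℝ × ℝ, fderiv ℝ (fun y => fderiv ℝ f y v) z w
      = fderiv ℝ (fderiv ℝ f) z w v := by
    intro v w
    rw [fderiv_clm_apply hd (differentiableAt_const v)]
    simp
  have h1 := h (1, 0) (0, 1)
  have h2 := h (0, 1) (1, 0)
  exact h1.trans ((hs.eq (0, 1) (1, 0)).trans h2.symm)

theorem pX_smul {c : ℝ × ℝ → ℝ} {f : ℝ × ℝ → E} (hc : ContDiff ℝ 1 c) (hf : ContDiff ℝ 2 f)
    (z : ℝ × ℝ) : pX (fun y => c y • f y) z = c z • pX f z + pX c z • f z := by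
  have h1 : DifferentiableAt ℝ c z := hc.differentiable (by norm_num) z
  have h2 : DifferentiableAt ℝ f z := hf.differentiable (by norm_num) z
  simp only [pX]
  rw [fderiv_fun_smul h1 h2]
  simp

theorem pT_smul {c : ℝ × ℝ → ℝ} {f : ℝ × ℝ → E} (hc : ContDiff ℝ 1 c) (hf : ContDiff ℝ 2 f)
    (z : ℝ × ℝ) : pT (fun y => c y • f y) z = c z • pT f z + pT c z • f z := by
  have h1 : DifferentiableAt ℝ c z := hc.differentiable (by norm_num) z
  have h2 : DifferentiableAt ℝ f z := hf.differentiable (by norm_num) z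
  simp only [pT]
  rw [fderiv_fun_smul h1 h2]
  simp

theorem coeffs_zero {u v w : E} (h : LinearIndependent ℝ ![u, v, w]) {a b c : ℝ}
    (he : a • u + b • v + c • w = 0) : a = 0 ∧ b = 0 ∧ c = 0 := by
  have := Fintype.linearIndependent_iff.1 h ![a, b, c] (by simpa [Fin.sum_univ_three] using he)
  exact ⟨this 0, this 1, this 2⟩

end Helpers

theorem mLXIX_compatibility_conditions
    (k τ ω₂ ω₃ : ℝ × ℝ → ℝ)
    (hk : ContDiff ℝ 1 k) (hτ : ContDiff ℝ 1 τ)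
    (hω₂ : ContDiff ℝ 1 ω₂) (hω₃ : ContDiff ℝ 1 ω₃)
    (e₁ e₂ e₃ : ℝ × ℝ → EuclideanSpace ℝ (Fin 3))
    (he₁ : ContDiff ℝ 2 e₁) (he₂ : ContDiff ℝ 2 e₂) (he₃ : ContDiff ℝ 2 e₃)
    (hli : ∀ z, LinearIndependent ℝ ![e₁ z, e₂ z, e₃ z])
    (hx₁ : ∀ z, pX e₁ z = k z • e₂ z)
    (hx₂ : ∀ z, pX e₂ z = (-(k z)) • e₁ z + τ z • e₃ z)
    (hx₃ : ∀ z, pX e₃ z = (-(τ z)) • e₂ z)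
    (ht₁ : ∀ z, pT e₁ z = ω₃ z • e₂ z - ω₂ z • e₃ z)
    (ht₂ : ∀ z, pT e₂ z = (-(ω₃ z)) • e₁ z)
    (ht₃ : ∀ z, pT e₃ z = ω₂ z • e₁ z) :
    ∀ z, pT k z = pX ω₃ z + τ z * ω₂ z ∧
      pT τ z = -(k z * ω₂ z) ∧
      pX ω₂ z = τ z * ω₃ z := by
  intro z
  have c1 := pT_pX_comm he₁ z
  have c3 := pT_pX_comm he₃ z
  have hsub : pX (fun y => ω₃ y • e₂ y - ω₂ y • e₃ y) z
      = pX (fun y => ω₃ y • e₂ y) z - pX (fun y => ω₂ y • e₃ y) z := by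
    have h1 : DifferentiableAt ℝ (fun y => ω₃ y • e₂ y) z :=
      (hω₃.differentiable (by norm_num) z).smul (he₂.differentiable (by norm_num) z)
    have h2 : DifferentiableAt ℝ (fun y => ω₂ y • e₃ y) z :=
      (hω₂.differentiable (by norm_num) z).smul (he₃.differentiable (by norm_num) z)
    simp only [pX]
    rw [fderiv_fun_sub h1 h2]
    simp
  have hneg : pT (fun y => -(τ y)) z = -pT τ z := by
    simp only [pT]
    rw [fderiv_fun_neg]
    simp
  rw [funext hx₁, funext ht₁, hsub, pT_smul hk he₂, pX_smul hω₃ he₂, pX_smul hω₂ he₃,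
    ht₂, hx₂, hx₃] at c1
  rw [funext hx₃, funext ht₃, pT_smul hτ.neg he₂, pX_smul hω₂ he₁, ht₂, hx₁, hneg] at c3
  obtain ⟨-, h2, h3⟩ := coeffs_zero (hli z) (a := 0)
    (b := pT k z - pX ω₃ z - τ z * ω₂ z) (c := pX ω₂ z - τ z * ω₃ z) (by
      rw [← sub_eq_zero] at c1
      rw [← c1]
      module)
  obtain ⟨-, h5, -⟩ := coeffs_zero (hli z) (a := τ z * ω₃ z - pX ω₂ z)
    (b := -pT τ z - k z * ω₂ z) (c := 0) (by
      rw [← sub_eq_zero] at c3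
      rw [← c3]
      module)
  refine ⟨by linarith, by linarith, by linarith⟩
end

section
/- Let S : ℝ × ℝ → EuclideanSpace ℝ (Fin 3) be twice continuously differentiable with ‖S‖ = 1, let k = ‖∂ₓS‖ > 0, and let u, v be continuously differentiable with u² < k² everywhere. Define the frame e₁ = S, e₂ = (∂ₓS)/k, e₃ = (S ×₃ ∂ₓS)/k and τ = ⟨∂ₓe₂, e₃⟩. Suppose S satisfies ∂ₜS = (1/k)( −√(k² − u²) ∂ₓS + u (S ×₃ ∂ₓS) ), suppose ∂ₓu = v √(k² − u²), and suppose the gauge condition ⟨∂ₜe₂, e₃⟩ = 0 holds everywhere. Then τ = v at every point. -/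
open scoped InnerProductSpace

theorem cross3_inner_right (a b : EuclideanSpace ℝ (Fin 3)) : ⟪b, cross3 a b⟫_ℝ = 0 := by
  simp [cross3, PiLp.inner_apply, Fin.sum_univ_three, crossProduct]
  ring

theorem cross3_inner_self (a b : EuclideanSpace ℝ (Fin 3)) :
    ⟪cross3 a b, cross3 a b⟫_ℝ = ⟪a, a⟫_ℝ * ⟪b, b⟫_ℝ - ⟪a, b⟫_ℝ ^ 2 := by
  simp only [cross3, PiLp.inner_apply, Fin.sum_univ_three, crossProduct]
  simp
  ring

theorem cross3_differentiable {a b : ℝ × ℝ → EuclideanSpace ℝ (Fin 3)}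
    (ha : Differentiable ℝ a) (hb : Differentiable ℝ b) :
    Differentiable ℝ (fun z => cross3 (a z) (b z)) := by
  rw [differentiable_euclidean] at ha hb ⊢
  have a0 := ha 0
  have a1 := ha 1
  have a2 := ha 2
  have b0 := hb 0
  have b1 := hb 1
  have b2 := hb 2
  intro i
  fin_cases i <;> simp [cross3, crossProduct] <;> fun_prop

theorem mLXIX_torsion_equals_v
    (S : ℝ × ℝ → EuclideanSpace ℝ (Fin 3))
    (hS : ContDiff ℝ 2 S)
    (hunit : ∀ z, ‖S z‖ = 1)
    (k : ℝ × ℝ → ℝ) (hk : ∀ z, k z = ‖pX S z‖) (hkpos : ∀ z, 0 < k z)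
    (u v : ℝ × ℝ → ℝ) (hu_smooth : ContDiff ℝ 1 u) (hv_smooth : ContDiff ℝ 1 v)
    (hu : ∀ z, (u z) ^ 2 < (k z) ^ 2)
    (e₁ e₂ e₃ : ℝ × ℝ → EuclideanSpace ℝ (Fin 3))
    (he₁ : ∀ z, e₁ z = S z)
    (he₂ : ∀ z, e₂ z = (k z)⁻¹ • pX S z)
    (he₃ : ∀ z, e₃ z = (k z)⁻¹ • cross3 (S z) (pX S z))
    (τ : ℝ × ℝ → ℝ) (hτ : ∀ z, τ z = ⟪pX e₂ z, e₃ z⟫_ℝ)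
    (heq : ∀ z, pT S z = (k z)⁻¹ •
      ((-Real.sqrt ((k z) ^ 2 - (u z) ^ 2)) • pX S z + u z • cross3 (S z) (pX S z)))
    (hux : ∀ z, pX u z = v z * Real.sqrt ((k z) ^ 2 - (u z) ^ 2))
    (hgauge : ∀ z, ⟪pT e₂ z, e₃ z⟫_ℝ = 0) :
    ∀ z, τ z = v z := by
  have hfd : ContDiff ℝ 1 (fderiv ℝ S) := hS.fderiv_right (by norm_num)
  have hfdd : Differentiable ℝ (fderiv ℝ S) := hfd.differentiable (by norm_num)
  have hSd : Differentiable ℝ S := hS.differentiable (by norm_num)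
  have hud : Differentiable ℝ u := hu_smooth.differentiable (by norm_num)
  have hPd : Differentiable ℝ (pX S) := by
    unfold pX
    fun_prop
  have hkd : Differentiable ℝ k := by
    have : k = fun z => ‖pX S z‖ := funext hk
    rw [this]
    refine hPd.norm ℝ (fun z h => ?_)
    have := hkpos z
    rw [hk z, h] at this
    simp at this
  have hk0 : ∀ z, k z ≠ 0 := fun z => (hkpos z).ne'
  have he₂d : Differentiable ℝ e₂ := by
    rw [funext he₂]
    exact (hkd.inv hk0).smul hPd
  have he₃d : Differentiable ℝ e₃ := by
    rw [funext he₃]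
    exact (hkd.inv hk0).smul (cross3_differentiable hSd hPd)
  have hpos : ∀ z, 0 < k z ^ 2 - u z ^ 2 := fun z => sub_pos.2 (hu z)
  obtain ⟨w, hw⟩ : ∃ w : ℝ × ℝ → ℝ, w = fun z => Real.sqrt (k z ^ 2 - u z ^ 2) := ⟨_, rfl⟩
  have hwd : Differentiable ℝ w := by
    rw [hw]
    exact ((hkd.pow 2).sub (hud.pow 2)).sqrt (fun z => (hpos z).ne')
  have hwpos : ∀ z, 0 < w z := fun z => by
    rw [hw]; exact Real.sqrt_pos.2 (hpos z)
  have hP : pX S = fun z => k z • e₂ z := by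
    funext z
    rw [he₂, smul_inv_smul₀ (hk0 z)]
  have hQ : pT S = fun z => u z • e₃ z - w z • e₂ z := by
    funext z
    rw [heq, he₂, he₃, hw]
    module
  -- orthonormality
  have h23 : ∀ z, ⟪e₂ z, e₃ z⟫_ℝ = 0 := fun z => by
    rw [he₂, he₃, real_inner_smul_left, real_inner_smul_right, cross3_inner_right]
    simp
  have hSP : ∀ z, ⟪S z, pX S z⟫_ℝ = 0 := fun z => by
    have h1 : (fun z => ⟪S z, S z⟫_ℝ) = fun _ => (1 : ℝ) := by
      funext y
      rw [real_inner_self_eq_norm_sq, hunit]; norm_num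
    have h2 := fderiv_inner_apply ℝ (hSd z) (hSd z) ((1 : ℝ), (0 : ℝ))
    rw [h1, real_inner_comm (S z)] at h2
    simp at h2
    rw [pX]
    linarith [real_inner_comm (S z) ((fderiv ℝ S z) (1, 0))]
  have h33 : ∀ z, ⟪e₃ z, e₃ z⟫_ℝ = 1 := fun z => by
    rw [he₃, real_inner_smul_left, real_inner_smul_right, cross3_inner_self, hSP,
      real_inner_self_eq_norm_sq, real_inner_self_eq_norm_sq, hunit, ← hk]
    have := hk0 z
    field_simp
    norm_num
  have h3x : ∀ z, ⟪pX e₃ z, e₃ z⟫_ℝ = 0 := fun z => by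
    have h2 := fderiv_inner_apply ℝ (he₃d z) (he₃d z) ((1 : ℝ), (0 : ℝ))
    rw [funext h33] at h2
    simp at h2
    rw [pX]
    linarith [real_inner_comm (e₃ z) ((fderiv ℝ e₃ z) (1, 0))]
  intro z
  -- equality of mixed partial derivatives
  have hsymm : pT (pX S) z = pX (pT S) z := by
    have hs : IsSymmSndFDerivAt ℝ S z :=
      hS.contDiffAt.isSymmSndFDerivAt (by simp)
    have h := hs.eq (0, 1) (1, 0)
    have key : ∀ a b : ℝ × ℝ, fderiv ℝ (fun y => fderiv ℝ S y a) z b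
        = fderiv ℝ (fderiv ℝ S) z b a := fun a b => by
      rw [fderiv_clm_apply (hfdd z) (differentiableAt_const a)]
      simp
    have e1 : pT (pX S) z = fderiv ℝ (fun y => fderiv ℝ S y (1, 0)) z (0, 1) := rfl
    have e2 : pX (pT S) z = fderiv ℝ (fun y => fderiv ℝ S y (0, 1)) z (1, 0) := rfl
    rw [e1, e2, key, key, h]
  have hL : pT (pX S) z = k z • pT e₂ z + pT k z • e₂ z := by
    rw [hP]
    unfold pT
    rw [fderiv_fun_smul (hkd z) (he₂d z)]
    simp
  have hR : pX (pT S) z = (u z • pX e₃ z + pX u z • e₃ z) - (w z • pX e₂ z + pX w z • e₂ z) := by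
    rw [hQ]
    unfold pX
    rw [fderiv_fun_sub ((hud z).fun_smul (he₃d z)) ((hwd z).fun_smul (he₂d z)),
      fderiv_fun_smul (hud z) (he₃d z), fderiv_fun_smul (hwd z) (he₂d z)]
    simp
  rw [hL, hR] at hsymm
  have h := congrArg (fun x => ⟪x, e₃ z⟫_ℝ) hsymm
  simp only [inner_add_left, inner_sub_left, real_inner_smul_left, hgauge, h23, h3x, h33,
    ← hτ] at h
  have hux' : pX u z = v z * w z := by rw [hux, hw]
  rw [hux'] at h
  have h0 : w z * (τ z - v z) = 0 := by linarith
  rcases mul_eq_zero.1 h0 with h1 | h1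
  · exact absurd h1 (hwpos z).ne'
  · linarith
end

section
/- Let k, τ, ω₂, ω₃ : ℝ × ℝ → ℝ be continuously differentiable and define the 2×2 complex matrix-valued functions U = (1/(2i))·[[τ, k], [k, −τ]] and V = (1/(2i))·[[0, ω₃ − iω₂], [ω₃ + iω₂, 0]]. Then the zero-curvature equation ∂ₜU − ∂ₓV + U·V − V·U = 0 holds at every point if and only if the system ∂ₜk = ∂ₓω₃ + τω₂, ∂ₜτ = −k ω₂, ∂ₓω₂ = τω₃ holds at every point. In other words, the L-equivalent system (6) of the M-LXIX equation admits a zero-curvature (Lax) representation by 2×2 traceless matrices. -/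
/-- Entrywise partial derivative in `x` of a matrix-valued function. -/
noncomputable def pXM {m n R : Type*} [NormedAddCommGroup R] [NormedSpace ℝ R]
    (A : ℝ × ℝ → Matrix m n R) (z : ℝ × ℝ) : Matrix m n R :=
  Matrix.of fun i j => pX (fun w => A w i j) z

/-- Entrywise partial derivative in `t` of a matrix-valued function. -/
noncomputable def pTM {m n R : Type*} [NormedAddCommGroup R] [NormedSpace ℝ R]
    (A : ℝ × ℝ → Matrix m n R) (z : ℝ × ℝ) : Matrix m n R :=
  Matrix.of fun i j => pT (fun w => A w i j) z

lemma fderiv_lin_comb_aux (f g : ℝ × ℝ → ℝ) (hf : ContDiff ℝ 1 f) (hg : ContDiff ℝ 1 g)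
    (a b : ℂ) (z v : ℝ × ℝ) :
    fderiv ℝ (fun w => a * (f w : ℂ) + b * (g w : ℂ)) z v =
      a * (fderiv ℝ f z v : ℂ) + b * (fderiv ℝ g z v : ℂ) := by
  have hf' := (hf.differentiable one_ne_zero z).hasFDerivAt
  have hg' := (hg.differentiable one_ne_zero z).hasFDerivAt
  have h1 : HasFDerivAt (fun w => (f w : ℂ)) (Complex.ofRealCLM.comp (fderiv ℝ f z)) z :=
    Complex.ofRealCLM.hasFDerivAt.comp z hf'
  have h2 : HasFDerivAt (fun w => (g w : ℂ)) (Complex.ofRealCLM.comp (fderiv ℝ g z)) z :=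
    Complex.ofRealCLM.hasFDerivAt.comp z hg'
  have h3 : HasFDerivAt (fun w => a * (f w : ℂ) + b * (g w : ℂ)) _ z :=
    (h1.const_mul a).add (h2.const_mul b)
  rw [h3.fderiv]
  simp

theorem mLXIX_Lax_representation
    (k τ ω₂ ω₃ : ℝ × ℝ → ℝ)
    (hk : ContDiff ℝ 1 k) (hτ : ContDiff ℝ 1 τ)
    (hω₂ : ContDiff ℝ 1 ω₂) (hω₃ : ContDiff ℝ 1 ω₃)
    (U V : ℝ × ℝ → Matrix (Fin 2) (Fin 2) ℂ)
    (hU : ∀ z, U z = (1 / (2 * Complex.I)) •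
      !![(τ z : ℂ), (k z : ℂ); (k z : ℂ), -(τ z : ℂ)])
    (hV : ∀ z, V z = (1 / (2 * Complex.I)) •
      !![0, (ω₃ z : ℂ) - Complex.I * (ω₂ z : ℂ);
         (ω₃ z : ℂ) + Complex.I * (ω₂ z : ℂ), 0]) :
    (∀ z, pTM U z - pXM V z + U z * V z - V z * U z = 0) ↔
    (∀ z, pT k z = pX ω₃ z + τ z * ω₂ z ∧
      pT τ z = -(k z * ω₂ z) ∧
      pX ω₂ z = τ z * ω₃ z) := by
  have key : ∀ z, (pTM U z - pXM V z + U z * V z - V z * U z = 0) ↔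
      (pT k z = pX ω₃ z + τ z * ω₂ z ∧ pT τ z = -(k z * ω₂ z) ∧ pX ω₂ z = τ z * ω₃ z) := by
    intro z
    have hc : (1 / (2 * Complex.I) : ℂ) = -Complex.I / 2 := by
      field_simp
      simp
    rw [hc] at hU hV
    have hUT : pTM U z = (-Complex.I / 2) •
        !![((pT τ z : ℝ) : ℂ), ((pT k z : ℝ) : ℂ); ((pT k z : ℝ) : ℂ), -((pT τ z : ℝ) : ℂ)] := by
      have e1 := fderiv_lin_comb_aux τ k hτ hk (-Complex.I / 2) 0 z (0, 1)
      have e2 := fderiv_lin_comb_aux τ k hτ hk 0 (-Complex.I / 2) z (0, 1)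
      have e3 := fderiv_lin_comb_aux τ k hτ hk (Complex.I / 2) 0 z (0, 1)
      ext i j
      fin_cases i <;> fin_cases j
      · refine Eq.trans ?_ (e1.trans ?_)
        · simp [pTM, pT, hU]
        · simp [pT]
      · refine Eq.trans ?_ (e2.trans ?_)
        · simp [pTM, pT, hU]
        · simp [pT]
      · refine Eq.trans ?_ (e2.trans ?_)
        · simp [pTM, pT, hU]
        · simp [pT]
      · refine Eq.trans ?_ (e3.trans ?_)
        · simp [pTM, pT, hU, neg_div]
        · simp [pT, neg_div]
    have hVX : pXM V z = (-Complex.I / 2) •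
        !![0, ((pX ω₃ z : ℝ) : ℂ) - Complex.I * ((pX ω₂ z : ℝ) : ℂ);
         ((pX ω₃ z : ℝ) : ℂ) + Complex.I * ((pX ω₂ z : ℝ) : ℂ), 0] := by
      have e1 := fderiv_lin_comb_aux ω₃ ω₂ hω₃ hω₂ (-Complex.I / 2)
        (-Complex.I / 2 * -Complex.I) z (1, 0)
      have e2 := fderiv_lin_comb_aux ω₃ ω₂ hω₃ hω₂ (-Complex.I / 2)
        (-Complex.I / 2 * Complex.I) z (1, 0)
      ext i j
      fin_cases i <;> fin_cases j
      · simp [pXM, pX, hV]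
      · refine Eq.trans ?_ (e1.trans ?_)
        · simp only [pXM, pX, hV, Matrix.of_apply]
          congr 2
          funext w
          simp
          ring
        · simp [pX]
          ring
      · refine Eq.trans ?_ (e2.trans ?_)
        · simp only [pXM, pX, hV, Matrix.of_apply]
          congr 2
          funext w
          simp
          ring
        · simp [pX]
          ring
      · simp [pXM, pX, hV]
    rw [hUT, hVX, hU, hV, ← Matrix.ext_iff]
    simp [Fin.forall_fin_two, Complex.ext_iff]
    constructor
    · rintro ⟨⟨h1, h2, h3⟩, ⟨h4, h5⟩, h6⟩
      refine ⟨?_, ?_, ?_⟩ <;> linarith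
    · rintro ⟨h1, h2, h3⟩
      rw [h1, h2, h3]
      ring_nf
      simp
  exact forall_congr' key
end
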